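/- If d ≥ n² + 3n, then every X ∈ 𝔹^{d×n}_{≠0} satisfies C_P(X) ≤ C_D(X). Symmetrically, if n ≥ d² + 3d, then every X ∈ 𝔹^{d×n}_{≠0} satisfies C_D(X) ≤ C_P(X). -/

import Mathlib

open scoped BigOperators

/-- Number of nonzero entries of row `i` of `X`. -/
noncomputable def nnzRow {d n : ℕ} (X : Matrix (Fin d) (Fin n) ℝ) (i : Fin d) : ℕ :=
  (Finset.univ.filter fun j => X i j ≠ 0).card

/-- Number of nonzero entries of column `j` of `X`. -/
noncomputable def nnzCol {d n : ℕ} (X : Matrix (Fin d) (Fin n) ℝ) (j : Fin n) : ℕ :=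
  (Finset.univ.filter fun i => X i j ≠ 0).card

/-- Total number of nonzero entries of `X`. -/
noncomputable def nnz {d n : ℕ} (X : Matrix (Fin d) (Fin n) ℝ) : ℕ :=
  ∑ i, nnzRow X i

/-- `X` has all its entries in `{−1, 0, 1}`. -/
def IsBinary {d n : ℕ} (X : Matrix (Fin d) (Fin n) ℝ) : Prop :=
  ∀ i j, X i j = -1 ∨ X i j = 0 ∨ X i j = 1

/-- `X` has no zero row and no zero column. -/
def NoZeroRowCol {d n : ℕ} (X : Matrix (Fin d) (Fin n) ℝ) : Prop :=
  (∀ i, ∃ j, X i j ≠ 0) ∧ (∀ j, ∃ i, X i j ≠ 0)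

/-- For binary matrices, `C_P(X) = ∑ᵢ ‖X₍i:₎‖₀²`. -/
noncomputable def CP {d n : ℕ} (X : Matrix (Fin d) (Fin n) ℝ) : ℕ :=
  ∑ i, nnzRow X i ^ 2

/-- For binary matrices, `C_D(X) = ∑ⱼ ‖X₍:j₎‖₀²`. -/
noncomputable def CD {d n : ℕ} (X : Matrix (Fin d) (Fin n) ℝ) : ℕ :=
  ∑ j, nnzCol X j ^ 2

/-- `ā_b = b⌊a/b⌋`: `a` rounded down to the closest multiple of `b`. -/
def rnd (a b : ℕ) : ℕ := b * (a / b)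

/-- `L(α, n) = (1/n)(ᾱ_n² + (α − ᾱ_n)(2ᾱ_n + n))`. -/
noncomputable def Lfun (α n : ℕ) : ℝ :=
  (1 / (n : ℝ)) * ((rnd α n : ℝ) ^ 2 +
    ((α - rnd α n : ℕ) : ℝ) * (2 * (rnd α n : ℝ) + (n : ℝ)))

/-- `U(α, d, n) = (d+1)·(α−n)̄_{d−1} + n − 1 + (α − n + 1 − (α−n)̄_{d−1})²`. -/
noncomputable def Ufun (α d n : ℕ) : ℝ :=
  ((d : ℝ) + 1) * (rnd (α - n) (d - 1) : ℝ) + (n : ℝ) - 1 +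
    ((α - n + 1 - rnd (α - n) (d - 1) : ℕ) : ℝ) ^ 2

theorem aux_sum_sq {d n : ℕ} (h : n ^ 2 + 3 * n ≤ d) (r : Fin d → ℕ) (c : Fin n → ℕ)
    (hrc : ∑ i, r i = ∑ j, c j) (h1 : ∀ i, 1 ≤ r i) (h2 : ∀ i, r i ≤ n) :
    ∑ i, r i ^ 2 ≤ ∑ j, c j ^ 2 := by
  have hA : d ≤ ∑ i, r i := by
    have := Finset.sum_le_sum (s := Finset.univ) fun i _ => h1 i
    simpa using this
  have hP : ∑ i, r i ^ 2 ≤ n * ∑ i, r i := by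
    rw [Finset.mul_sum]
    refine Finset.sum_le_sum fun i _ => ?_
    rw [sq]
    exact Nat.mul_le_mul_right _ (h2 i)
  have hC : (∑ j, c j) ^ 2 ≤ n * ∑ j, c j ^ 2 := by
    have := sq_sum_le_card_mul_sum_sq (s := (Finset.univ : Finset (Fin n))) (f := c)
    simpa using this
  rw [← hrc] at hC
  rcases Nat.eq_zero_or_pos n with hn | hn
  · rw [hn] at hP
    omega
  · refine Nat.le_of_mul_le_mul_left ?_ hn
    nlinarith

theorem aux_sum_eq {d n : ℕ} (X : Matrix (Fin d) (Fin n) ℝ) :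
    ∑ i, nnzRow X i = ∑ j, nnzCol X j := by
  simp only [nnzRow, nnzCol, Finset.card_filter]
  exact Finset.sum_comm

/-- If `d ≥ n² + 3n`, then every binary `d×n` matrix with no zero row or column
satisfies `C_P(X) ≤ C_D(X)`; symmetrically, if `n ≥ d² + 3d`, then every such
matrix satisfies `C_D(X) ≤ C_P(X)`. -/
theorem many_features_binary
    (d n : ℕ) :
    (n ^ 2 + 3 * n ≤ d → ∀ X : Matrix (Fin d) (Fin n) ℝ,
      IsBinary X → NoZeroRowCol X → CP X ≤ CD X) ∧
    (d ^ 2 + 3 * d ≤ n → ∀ X : Matrix (Fin d) (Fin n) ℝ,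
      IsBinary X → NoZeroRowCol X → CD X ≤ CP X) := by
  constructor
  · intro h X _ hX
    refine aux_sum_sq h _ _ (aux_sum_eq X) (fun i => ?_) (fun i => ?_)
    · obtain ⟨j, hj⟩ := hX.1 i
      exact Finset.card_pos.2 ⟨j, by simpa using hj⟩
    · exact (Finset.card_le_univ _).trans (by simp)
  · intro h X _ hX
    refine aux_sum_sq h _ _ (aux_sum_eq X).symm (fun j => ?_) (fun j => ?_)
    · obtain ⟨i, hi⟩ := hX.2 j
      exact Finset.card_pos.2 ⟨i, by simpa using hi⟩
    · exact (Finset.card_le_univ _).trans (by simp)
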